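/- arXiv:2005.09403 — 3 statements merged into one kernel-verified Lean document; each statement's English description precedes it below -/
import Mathlib

section
/- For every function F : ℕ → ℝ, the set of irrational numbers α such that q_{n+1} ≥ F(q_n) holds for infinitely many n, where (q_n) is the sequence of continued fraction denominators of α, is a dense G_δ subset of ℝ. -/
/-- Iterates of the Gauss map applied to the fractional part of `α`:
`cfX α 0 = {α}`, `cfX α (n+1) = {1 / cfX α n}`. -/
noncomputable def cfX (α : ℝ) : ℕ → ℝ
  | 0 => Int.fract α
  | n + 1 => Int.fract (cfX α n)⁻¹

/-- The partial quotients of `α`: `cfPQ α (n-1)` is the `n`-th partial quotient `a_n`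
of the continued fraction expansion of `α` (for `n ≥ 1`). -/
noncomputable def cfPQ (α : ℝ) (n : ℕ) : ℕ := ⌊(cfX α n)⁻¹⌋₊

/-- The denominators of the continued fraction expansion of `α`, with the convention
`q_0 = q_1 = 1` and `q_{n+1} = a_n q_n + q_{n-1}` where `(a_n)` are the partial quotients. -/
noncomputable def cfDenom (α : ℝ) : ℕ → ℕ
  | 0 => 1
  | 1 => 1
  | n + 2 => cfPQ α n * cfDenom α (n + 1) + cfDenom α n

open Filter Topology

theorem cfX_nonneg (α : ℝ) (n : ℕ) : 0 ≤ cfX α n := by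
  cases n <;> exact Int.fract_nonneg _

theorem irrational_cfX {α : ℝ} (h : Irrational α) (n : ℕ) : Irrational (cfX α n) := by
  induction n with
  | zero => exact h.sub_intCast ⌊α⌋
  | succ n ih => exact ih.inv.sub_intCast ⌊(cfX α n)⁻¹⌋

theorem exists_cfX_ratCast_eq_zero (r : ℚ) : ∃ n, cfX (r : ℝ) n = 0 := by
  by_contra! h
  have key : ∀ n : ℕ, ∃ q : ℚ, cfX (r : ℝ) n = q ∧ q.num + n ≤ (Int.fract r).num := by
    intro n
    induction n with
    | zero => exact ⟨Int.fract r, by simp [cfX], by simp⟩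
    | succ n ih =>
      obtain ⟨q, hq, hle⟩ := ih
      have hpos : 0 < q := by
        have := (cfX_nonneg r n).lt_of_ne' (h n)
        rw [hq] at this
        exact_mod_cast this
      refine ⟨Int.fract q⁻¹, by simp [cfX, hq], ?_⟩
      have := Rat.fract_inv_num_lt_num_of_pos hpos
      push_cast
      omega
  obtain ⟨q, hq, hle⟩ := key ((Int.fract r).num.toNat + 1)
  have hq0 : 0 ≤ q := by
    have := cfX_nonneg r ((Int.fract r).num.toNat + 1)
    rw [hq] at this
    exact_mod_cast this
  have := Rat.num_nonneg.2 hq0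
  omega

theorem continuousAt_fract_of_ne_zero {x : ℝ} (h : Int.fract x ≠ 0) :
    ContinuousAt (Int.fract : ℝ → ℝ) x := by
  have hlt : (⌊x⌋ : ℝ) < x := by
    have := (Int.fract_nonneg x).lt_of_ne' h
    rw [Int.fract] at this
    linarith
  have hev : ∀ᶠ y : ℝ in 𝓝 x, y - (⌊x⌋ : ℝ) = Int.fract y := by
    filter_upwards [Ioo_mem_nhds hlt (Int.lt_floor_add_one x)] with y hy
    rw [Int.fract, Int.floor_eq_iff.2 ⟨hy.1.le, hy.2⟩]
  exact (continuousAt_id.sub continuousAt_const).congr hev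

theorem continuousAt_cfX {α : ℝ} {n : ℕ} (h : ∀ k ≤ n, cfX α k ≠ 0) :
    ContinuousAt (fun β => cfX β n) α := by
  induction n with
  | zero => exact continuousAt_fract_of_ne_zero (h 0 le_rfl)
  | succ n ih =>
    exact ContinuousAt.comp (g := (Int.fract : ℝ → ℝ)) (f := fun β => (cfX β n)⁻¹)
      (continuousAt_fract_of_ne_zero (h (n + 1) le_rfl))
      ((ih fun k hk => h k (hk.trans n.le_succ)).inv₀ (h n n.le_succ))

theorem eventually_cfPQ_eq {α : ℝ} {n : ℕ} (h : ∀ k ≤ n + 1, cfX α k ≠ 0) :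
    ∀ᶠ β in 𝓝 α, cfPQ β n = cfPQ α n := by
  have hc : ContinuousAt (fun β => (cfX β n)⁻¹) α :=
    (continuousAt_cfX fun k hk => h k (hk.trans n.le_succ)).inv₀ (h n n.le_succ)
  have h0 : 0 ≤ (cfX α n)⁻¹ := inv_nonneg.2 (cfX_nonneg α n)
  have hlt : ((cfPQ α n : ℕ) : ℝ) < (cfX α n)⁻¹ := by
    refine (Nat.floor_le h0).lt_of_ne fun he => h (n + 1) le_rfl ?_
    change Int.fract (cfX α n)⁻¹ = 0
    rw [← he, Int.fract_natCast]
  filter_upwards [hc.eventually (Ioo_mem_nhds hlt (Nat.lt_floor_add_one _))] with β hβ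
  exact (Nat.floor_eq_iff (inv_nonneg.2 (cfX_nonneg β n))).2 ⟨hβ.1.le, hβ.2⟩

theorem eventually_cfDenom_eq {α : ℝ} {n : ℕ} (h : ∀ k < n, cfX α k ≠ 0) :
    ∀ᶠ β in 𝓝 α, cfDenom β n = cfDenom α n := by
  induction n using Nat.strong_induction_on with
  | _ n ih =>
    match n with
    | 0 | 1 => exact Eventually.of_forall fun _ => rfl
    | n + 2 =>
      filter_upwards [ih (n + 1) (by omega) fun k hk => h k (by omega),
        ih n (by omega) fun k hk => h k (by omega),
        eventually_cfPQ_eq (n := n) fun k hk => h k (by omega)] with β h1 h2 h3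
      simp only [cfDenom, h1, h2, h3]

theorem cfDenom_pos (α : ℝ) (n : ℕ) : 0 < cfDenom α n := by
  induction n using Nat.strong_induction_on with
  | _ n ih =>
    match n with
    | 0 | 1 => exact Nat.one_pos
    | n + 2 => exact Nat.add_pos_right _ (ih n (by omega))

theorem cfPQ_le_cfDenom (α : ℝ) (n : ℕ) : cfPQ α n ≤ cfDenom α (n + 2) :=
  (Nat.le_mul_of_pos_right _ (cfDenom_pos α (n + 1))).trans (Nat.le_add_right _ _)

theorem le_cfPQ {α : ℝ} {n M : ℕ} (h0 : 0 < cfX α n) (h : cfX α n * M ≤ 1) :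
    M ≤ cfPQ α n := by
  refine Nat.le_floor ?_
  rw [← one_div, le_div_iff₀ h0]
  linarith

/-- Near a zero of `cfX · (p + 1)`, the value `(cfX α p)⁻¹` is close to an integer: slightly above
it the next partial quotient is large, slightly below it the one after that is. -/
theorem eventually_exists_le_cfDenom (F : ℕ → ℝ) {r : ℝ} {p : ℕ} (h : ∀ k ≤ p, cfX r k ≠ 0)
    (hz : cfX r (p + 1) = 0) :
    ∀ᶠ α in 𝓝 r, Irrational α → ∃ n ≥ p, F (cfDenom α n) ≤ (cfDenom α (n + 1) : ℝ) := by
  obtain ⟨m, hm⟩ : ∃ m : ℤ, (cfX r p)⁻¹ = m :=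
    ⟨⌊(cfX r p)⁻¹⌋, sub_eq_zero.1 hz⟩
  set Q₀ := cfDenom r p
  set Q₁ := cfDenom r (p + 1)
  set A := m.toNat * Q₁ + Q₀
  set B := 1 * ((m - 1).toNat * Q₁ + Q₀) + Q₁
  obtain ⟨M, hM⟩ := exists_nat_ge (max (F A) (F B))
  have hc : ContinuousAt (fun β => (cfX β p)⁻¹) r := (continuousAt_cfX h).inv₀ (h p le_rfl)
  have hδ : (0 : ℝ) < 1 / (M + 2) := by positivity
  have hball := hc.eventually (Metric.ball_mem_nhds _ hδ)
  filter_upwards [hball, eventually_cfDenom_eq (n := p) fun k hk => h k hk.le,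
    eventually_cfDenom_eq (n := p + 1) fun k hk => h k (by omega)] with α hα h0 h1 hirr
  rw [hm, Real.dist_eq, abs_lt, lt_div_iff₀ (by positivity), neg_lt,
    lt_div_iff₀ (by positivity)] at hα
  obtain ⟨hα₁, hα₂⟩ := hα
  set y := (cfX α p)⁻¹ with hy
  have hM0 : (0 : ℝ) ≤ M := M.cast_nonneg
  have hfl : (cfPQ α p : ℕ) = ⌊y⌋.toNat := Int.floor_toNat _ |>.symm
  have hx : cfX α (p + 1) = y - ⌊y⌋ := rfl
  have pos (n : ℕ) : 0 < cfX α n := (cfX_nonneg α n).lt_of_ne' (irrational_cfX hirr n).ne_zero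
  rcases le_or_gt (m : ℝ) y with hle | hlt
  · have hfloor : ⌊y⌋ = m := Int.floor_eq_iff.2 ⟨hle, by nlinarith⟩
    have hA : cfDenom α (p + 2) = A := by
      simp only [cfDenom, h0, h1, hfl, hfloor, A, Q₀, Q₁]
    refine ⟨p + 2, by omega, ?_⟩
    rw [hA]
    refine ((le_max_left _ _).trans hM).trans (Nat.cast_le.2 ?_)
    refine le_trans (le_cfPQ (pos (p + 1)) ?_) (cfPQ_le_cfDenom α (p + 1))
    rw [hx, hfloor]
    nlinarith
  · have hfloor : ⌊y⌋ = m - 1 := Int.floor_eq_iff.2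
      ⟨by push_cast; nlinarith, by push_cast; linarith⟩
    rw [hfloor] at hx
    push_cast at hx
    set x := cfX α (p + 1)
    have hx0 : 0 < x := pos (p + 1)
    have hx1 : x * 2 > 1 := by nlinarith
    have hxlt : x < 1 := by linarith
    have hinv : x * x⁻¹ = 1 := mul_inv_cancel₀ hx0.ne'
    have hinv1 : 1 ≤ x⁻¹ := by nlinarith
    have hinv2 : x⁻¹ < 2 := by nlinarith
    have hpq : cfPQ α (p + 1) = 1 :=
      (Nat.floor_eq_iff (inv_nonneg.2 hx0.le)).2
        ⟨by simpa using hinv1, by norm_num; exact hinv2⟩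
    have hx2 : cfX α (p + 2) = x⁻¹ - 1 := by
      have : ⌊x⁻¹⌋ = 1 := Int.floor_eq_iff.2 ⟨by simpa using hinv1, by norm_num; exact hinv2⟩
      change x⁻¹ - ⌊x⁻¹⌋ = _
      rw [this, Int.cast_one]
    have hB : cfDenom α (p + 3) = B := by
      simp only [cfDenom, h0, h1, hfl, hpq, hfloor, B, Q₀, Q₁]
    refine ⟨p + 3, by omega, ?_⟩
    rw [hB]
    refine ((le_max_right _ _).trans hM).trans (Nat.cast_le.2 ?_)
    refine le_trans (le_cfPQ (pos (p + 2)) ?_) (cfPQ_le_cfDenom α (p + 2))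
    rw [hx2]
    have hxM : (1 - x) * (M + 2) < 1 := by
      rw [hx]
      linarith
    have : (1 - x) * M ≤ x := by nlinarith
    have h2 : (x⁻¹ - 1) = x⁻¹ * (1 - x) := by
      rw [mul_sub, mul_one, mul_comm, hinv]
    rw [h2, mul_assoc]
    calc x⁻¹ * ((1 - x) * M) ≤ x⁻¹ * x := by gcongr
      _ = 1 := by rw [mul_comm, hinv]

theorem eventually_le_cfDenom {F : ℕ → ℝ} {α : ℝ} (h : Irrational α) {n : ℕ}
    (hn : F (cfDenom α n) ≤ (cfDenom α (n + 1) : ℝ)) :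
    ∀ᶠ β in 𝓝 α, F (cfDenom β n) ≤ (cfDenom β (n + 1) : ℝ) := by
  filter_upwards [eventually_cfDenom_eq (n := n) fun k _ => (irrational_cfX h k).ne_zero,
    eventually_cfDenom_eq (n := n + 1) fun k _ => (irrational_cfX h k).ne_zero] with β h0 h1
  rwa [h0, h1]

theorem Irrational.mem_interior_exists_le_cfDenom {F : ℕ → ℝ} {α : ℝ} (h : Irrational α) {N : ℕ}
    (hα : ∃ n ≥ N, F (cfDenom α n) ≤ (cfDenom α (n + 1) : ℝ)) :
    α ∈ interior {β : ℝ | ∃ n ≥ N, F (cfDenom β n) ≤ (cfDenom β (n + 1) : ℝ)} := by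
  obtain ⟨n, hN, hn⟩ := hα
  rw [mem_interior_iff_mem_nhds]
  filter_upwards [eventually_le_cfDenom h hn] with β hβ using ⟨n, hN, hβ⟩

theorem dense_interior_exists_le_cfDenom (F : ℕ → ℝ) (N : ℕ) :
    Dense (interior {α : ℝ | ∃ n ≥ N, F (cfDenom α n) ≤ (cfDenom α (n + 1) : ℝ)}) := by
  rw [dense_iff_inter_open]
  intro U hU hne
  obtain ⟨β, hβU, hβ⟩ := dense_irrational.inter_open_nonempty U hU hne
  have hev : ∀ᶠ x in 𝓝 β, x ∈ U ∧ ∀ k ∈ Set.Iic N, cfX x k ≠ 0 :=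
    (hU.eventually_mem hβU).and <| (Set.finite_Iic N).eventually_all.2 fun k _ =>
      (continuousAt_cfX fun j _ => (irrational_cfX hβ j).ne_zero).eventually_ne (irrational_cfX hβ k).ne_zero
  obtain ⟨_, ⟨hrU, hr⟩, r, rfl⟩ := mem_closure_iff_nhds.1 (Rat.denseRange_cast (𝕜 := ℝ) β) _ hev
  classical
  have hex := exists_cfX_ratCast_eq_zero r
  obtain ⟨p, hp⟩ : ∃ p, Nat.find hex = p + 1 :=
    Nat.exists_eq_succ_of_ne_zero fun h0 => hr 0 N.zero_le (h0 ▸ Nat.find_spec hex)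
  have hz : cfX (r : ℝ) (p + 1) = 0 := hp ▸ Nat.find_spec hex
  have hNp : N ≤ p := by
    by_contra! hlt
    exact hr (p + 1) hlt hz
  have hnear := eventually_exists_le_cfDenom F
    (fun k hk => Nat.find_min hex (m := k) (by omega)) hz
  obtain ⟨α, ⟨hαU, hα⟩, hirr⟩ := mem_closure_iff_nhds.1 (dense_irrational (r : ℝ)) _
    ((hU.eventually_mem hrU).and hnear)
  obtain ⟨n, hn, hF⟩ := hα hirr
  exact ⟨α, hαU, Irrational.mem_interior_exists_le_cfDenom hirr ⟨n, hNp.trans hn, hF⟩⟩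

/-- for every `F : ℕ → ℝ`, the set of irrational `α` whose continued fraction
denominators satisfy `q_{n+1} ≥ F(q_n)` for infinitely many `n` is a dense `G_δ` subset of `ℝ`. -/
theorem stmt10 (F : ℕ → ℝ) :
    Dense {α : ℝ | Irrational α ∧
        ∃ᶠ n in Filter.atTop, F (cfDenom α n) ≤ (cfDenom α (n + 1) : ℝ)} ∧
      IsGδ {α : ℝ | Irrational α ∧
        ∃ᶠ n in Filter.atTop, F (cfDenom α n) ≤ (cfDenom α (n + 1) : ℝ)} := by
  have heq : {α : ℝ | Irrational α ∧
      ∃ᶠ n in Filter.atTop, F (cfDenom α n) ≤ (cfDenom α (n + 1) : ℝ)} =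
      {α : ℝ | Irrational α} ∩
        ⋂ N, interior {α : ℝ | ∃ n ≥ N, F (cfDenom α n) ≤ (cfDenom α (n + 1) : ℝ)} := by
    ext α
    simp only [Set.mem_ofPred_eq, Set.mem_inter_iff, Set.mem_iInter, Filter.frequently_atTop]
    exact and_congr_right fun h => forall_congr' fun N =>
      ⟨h.mem_interior_exists_le_cfDenom, fun hα => by have := interior_subset hα; exact this⟩
  have hG : IsGδ (⋂ N, interior {α : ℝ | ∃ n ≥ N,
      F (cfDenom α n) ≤ (cfDenom α (n + 1) : ℝ)}) :=
    .iInter_of_isOpen fun _ => isOpen_interior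
  rw [heq]
  exact ⟨dense_irrational.inter_of_Gδ .setOfPred_irrational hG
    (dense_iInter_of_isOpen (fun _ => isOpen_interior) (dense_interior_exists_le_cfDenom F)),
    .inter .setOfPred_irrational hG⟩
end

section
/- Let α be irrational and let g : 𝕋 → ℝ be a function of bounded variation. Then sup_{x∈𝕋} |S_M(g)(x) − M ∫_𝕋 g dLeb| = o(M) as M → ∞; that is, (1/M)·sup_{x∈𝕋} |∑_{i=0}^{M−1} g(x + iα) − M ∫_𝕋 g dLeb| → 0 as M → ∞. -/
open MeasureTheory

/-- A `1`-periodic function of bounded variation on `[0, 1]` has its increments controlled by those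
of a function whose increments over unit intervals are constant. -/
lemma exists_quasiperiodic_control {g : ℝ → ℝ} (hper : Function.Periodic g 1)
    (hBV : eVariationOn g (Set.Icc 0 1) ≠ ⊤) :
    ∃ (W : ℝ → ℝ) (c : ℝ), (∀ t, W (t + 1) = W t + c) ∧
      ∀ a b, a ≤ b → |g b - g a| ≤ W b - W a := by
  have hloc : LocallyBoundedVariationOn g (Set.Icc 0 1) :=
    BoundedVariationOn.locallyBoundedVariationOn hBV
  have h0 : (0 : ℝ) ∈ Set.Icc (0 : ℝ) 1 := by simp
  have h1 : (1 : ℝ) ∈ Set.Icc (0 : ℝ) 1 := by simp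
  have hfr : ∀ t : ℝ, Int.fract t ∈ Set.Icc (0 : ℝ) 1 := fun t =>
    ⟨Int.fract_nonneg t, (Int.fract_lt_one t).le⟩
  have hg : ∀ t, g (Int.fract t) = g t := fun t => by
    simpa only [Int.fract, mul_one] using hper.sub_int_mul_eq (x := t) ⌊t⌋
  set V := variationOnFromTo g (Set.Icc 0 1) 0 with hV
  have hVle : ∀ {b d : ℝ}, b ∈ Set.Icc (0 : ℝ) 1 → d ∈ Set.Icc (0 : ℝ) 1 → b ≤ d →
      |g d - g b| ≤ V d - V b := fun hb hd hbd =>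
    variationOnFromTo.abs_sub_le_sub_of_le hloc h0 hb hd hbd
  have hV0 : V 0 = 0 := variationOnFromTo.self _ _ _
  have hV1 : 0 ≤ V 1 := variationOnFromTo.nonneg_of_le _ _ zero_le_one
  refine ⟨fun t => V (Int.fract t) + V 1 * ⌊t⌋, V 1, fun t => ?_, fun a b hab => ?_⟩
  · simp only [Int.fract_add_one, Int.floor_add_one]
    push_cast
    ring
  · rw [← hg a, ← hg b]
    rcases (Int.floor_mono hab).eq_or_lt with h | h
    · have hab' : Int.fract a ≤ Int.fract b := by
        simp only [Int.fract, h]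
        linarith
      simpa [h] using hVle (hfr a) (hfr b) hab'
    · have hA := hVle (hfr a) h1 (hfr a).2
      have hB := hVle h0 (hfr b) (hfr b).1
      have h01 : g 1 = g 0 := by simpa using hper 0
      have hfl : (⌊a⌋ : ℝ) + 1 ≤ ⌊b⌋ := by exact_mod_cast h
      have htri := abs_sub_le (g (Int.fract b)) (g 0) (g (Int.fract a))
      rw [h01] at hA
      nlinarith [mul_le_mul_of_nonneg_left hfl hV1]

lemma intervalIntegrable_of_control {g W : ℝ → ℝ}
    (hW : ∀ a b, a ≤ b → |g b - g a| ≤ W b - W a) (a b : ℝ) :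
    IntervalIntegrable g volume a b := by
  have h1 : Monotone W := fun x y hxy => by
    have := (abs_nonneg _).trans (hW x y hxy)
    linarith
  have h2 : Monotone (W - g) := fun x y hxy => by
    have := (le_abs_self _).trans (hW x y hxy)
    simp only [Pi.sub_apply]
    linarith
  simpa using (h1.intervalIntegrable (μ := volume) (a := a) (b := b)).sub h2.intervalIntegrable

lemma abs_mul_sub_integral_le_of_control {g W : ℝ → ℝ}
    (hW : ∀ a b, a ≤ b → |g b - g a| ≤ W b - W a) {a b a' b' t : ℝ} (ht : t ∈ Set.Icc a b)
    (ha : a ≤ a') (hab : a' ≤ b') (hb : b' ≤ b) :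
    |(b' - a') * g t - ∫ s in a'..b', g s| ≤ (b' - a') * (W b - W a) := by
  have hmono : Monotone W := fun x y hxy => by
    have := (abs_nonneg _).trans (hW x y hxy)
    linarith
  have hbound : ∀ s ∈ Set.uIoc a' b', ‖g t - g s‖ ≤ W b - W a := by
    intro s hs
    rw [Set.uIoc_of_le hab] at hs
    have h1 := hmono (ha.trans hs.1.le)
    have h2 := hmono (hs.2.trans hb)
    have h3 := hmono ht.1
    have h4 := hmono ht.2
    rw [Real.norm_eq_abs]
    rcases le_total s t with h | h
    · have := hW s t h
      linarith
    · have := hW t s h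
      rw [abs_sub_comm]
      linarith
  have hint : ∫ s in a'..b', (g t - g s) = (b' - a') * g t - ∫ s in a'..b', g s := by
    rw [intervalIntegral.integral_sub (by simp) (intervalIntegrable_of_control hW _ _)]
    simp
  have := intervalIntegral.norm_integral_le_of_norm_le_const hbound
  rwa [hint, Real.norm_eq_abs, abs_of_nonneg (sub_nonneg.2 hab), mul_comm (W b - W a)] at this

/-- A rotation by `p / q` with `p` and `q` coprime permutes the residues modulo `q`. -/
lemma Function.Periodic.sum_range_add_mul_div {F : ℝ → ℝ} (hF : Function.Periodic F 1) {p : ℤ}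
    {q : ℕ} (hq : 0 < q) (hpq : IsCoprime p q) (x : ℝ) :
    ∑ i ∈ Finset.range q, F (x + i * (p / q)) = ∑ j ∈ Finset.range q, F (x + j / q) := by
  have hq0 : (q : ℤ) ≠ 0 := by exact_mod_cast hq.ne'
  have hqR : (q : ℝ) ≠ 0 := by exact_mod_cast hq.ne'
  have hcast : ∀ i : ℕ, (((i * p % q).toNat : ℕ) : ℤ) = i * p % q := fun i =>
    Int.toNat_of_nonneg (Int.emod_nonneg _ hq0)
  have hmaps : Set.MapsTo (fun i : ℕ => (i * p % q : ℤ).toNat) (Finset.range q)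
      (Finset.range q) := by
    intro i _
    have := Int.emod_lt_of_pos (i * p) (by exact_mod_cast hq : (0 : ℤ) < q)
    simp only [Finset.coe_range, Set.mem_Iio]
    have := hcast i
    omega
  have hinj : Set.InjOn (fun i : ℕ => (i * p % q : ℤ).toNat) (Finset.range q) := by
    intro i hi j hj hij
    simp only [Finset.coe_range, Set.mem_Iio] at hi hj
    have h : (i * p % q : ℤ) = j * p % q := by
      rw [← hcast i, ← hcast j]
      exact congrArg _ hij
    have hdvd : (q : ℤ) ∣ (j - i) * p := by
      rw [sub_mul]
      exact Int.ModEq.dvd h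
    have hdvd' : (q : ℤ) ∣ j - i := hpq.symm.dvd_of_dvd_mul_right hdvd
    have : (i : ℤ) = j := by
      have h1 : (i : ℤ) % q = j % q := (Int.modEq_iff_dvd.2 hdvd')
      rwa [Int.emod_eq_of_lt (by positivity) (by exact_mod_cast hi),
        Int.emod_eq_of_lt (by positivity) (by exact_mod_cast hj)] at h1
    exact_mod_cast this
  refine Finset.sum_nbij _ hmaps hinj
    (Finset.surjOn_of_injOn_of_card_le _ hmaps hinj le_rfl) fun i _ => ?_
  have hdiv : ((i * p % q : ℤ) : ℝ) = i * p - q * ((i * p / q : ℤ) : ℝ) := by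
    rw [Int.emod_def]
    push_cast
    ring
  have hi : (((i * p % q : ℤ).toNat : ℕ) : ℝ) = ((i * p % q : ℤ) : ℝ) := by
    exact_mod_cast hcast i
  rw [hi, hdiv, ← hF.sub_int_mul_eq (x := x + i * (p / q)) (i * p / q : ℤ)]
  congr 1
  field_simp
  ring

/-- A form of the Denjoy–Koksma inequality. -/
lemma abs_birkhoff_sub_integral_le {g W : ℝ → ℝ} {c : ℝ} (hper : Function.Periodic g 1)
    (hWc : ∀ t, W (t + 1) = W t + c) (hW : ∀ a b, a ≤ b → |g b - g a| ≤ W b - W a)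
    {α : ℝ} {p : ℤ} {q : ℕ} (hq : 0 < q) (hpq : IsCoprime p q)
    (hα : |α - p / q| ≤ 1 / (q : ℝ) ^ 2) (x : ℝ) :
    |(∑ i ∈ Finset.range q, g (x + i * α)) - q * ∫ t in (0 : ℝ)..1, g t| ≤ 2 * c := by
  have hqR : (0 : ℝ) < q := by exact_mod_cast hq
  have hint := intervalIntegrable_of_control hW
  set D : ℝ → ℝ := fun u => W (u + 1 / q) - W (u - 1 / q) with hD
  set A : ℝ → ℝ := fun u => q * ∫ s in u..u + 1 / q, g s with hA
  have hDper : Function.Periodic D 1 := fun u => by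
    have h1 := hWc (u + 1 / q)
    have h2 := hWc (u - 1 / q)
    simp only [hD]
    rw [show u + 1 + 1 / (q : ℝ) = u + 1 / q + 1 by ring, h1,
      show u + 1 - 1 / (q : ℝ) = u - 1 / q + 1 by ring, h2]
    ring
  have hAper : Function.Periodic A 1 := fun u => by
    simp only [hA]
    rw [show u + 1 + 1 / (q : ℝ) = u + 1 / q + 1 by ring,
      ← intervalIntegral.integral_comp_add_right]
    congr 2
    exact funext hper
  have hAsum : ∑ j ∈ Finset.range q, A (x + j / q) = q * ∫ t in (0 : ℝ)..1, g t := by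
    have h := intervalIntegral.sum_integral_adjacent_intervals (f := g) (μ := volume)
      (a := fun j : ℕ => x + j / q) (n := q) fun k _ => hint _ _
    have hend := hper.intervalIntegral_add_eq x 0
    simp only [hA]
    rw [← Finset.mul_sum]
    congr 1
    rw [zero_add] at hend
    rw [← hend]
    convert h using 2
    · congr 1
      push_cast
      ring
    · simp
    · field_simp
  have hDsum : ∑ j ∈ Finset.range q, D (x + j / q) = 2 * c := by
    have h1 := Finset.sum_range_sub (fun j : ℕ => W (x + j / q)) q
    have h2 := Finset.sum_range_sub (fun j : ℕ => W (x + j / q - 1 / q)) q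
    have hq1 : (q : ℝ) / q = 1 := div_self hqR.ne'
    have h3 := hWc (x - 1 / q)
    have h4 : x + 1 - 1 / (q : ℝ) = x - 1 / q + 1 := by ring
    simp only [hq1, h4, hWc, Nat.cast_zero, zero_div, add_zero] at h1 h2
    calc ∑ j ∈ Finset.range q, D (x + j / q)
        = ∑ j ∈ Finset.range q, ((W (x + ((j + 1 : ℕ) : ℝ) / q) - W (x + j / q)) +
            (W (x + ((j + 1 : ℕ) : ℝ) / q - 1 / q) - W (x + j / q - 1 / q))) := by
          refine Finset.sum_congr rfl fun j _ => ?_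
          have e1 : x + ((j + 1 : ℕ) : ℝ) / q = x + j / q + 1 / q := by
            push_cast
            ring
          rw [e1, add_sub_cancel_right]
          simp only [hD]
          ring
      _ = 2 * c := by
          rw [Finset.sum_add_distrib, h1, h2]
          ring
  have hpt : ∀ i ∈ Finset.range q,
      |g (x + i * α) - A (x + i * (p / q))| ≤ D (x + i * (p / q)) := by
    intro i hi
    have hiq : (i : ℝ) ≤ q := by exact_mod_cast (Finset.mem_range.1 hi).le
    have hq' : 0 < 1 / (q : ℝ) := by positivity
    have hclose : |i * (α - p / q)| ≤ 1 / q := by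
      rw [abs_mul, abs_of_nonneg (Nat.cast_nonneg i)]
      calc (i : ℝ) * |α - p / q| ≤ q * (1 / (q : ℝ) ^ 2) := by gcongr
        _ = 1 / q := by field_simp
    have hclose' := abs_le.1 hclose
    set u := x + i * (p / q : ℝ) with hu
    have hmem : x + i * α ∈ Set.Icc (u - 1 / q) (u + 1 / q) := by
      constructor <;> (simp only [hu]; linarith)
    have h := abs_mul_sub_integral_le_of_control hW hmem (a' := u) (b' := u + 1 / q)
      (by linarith) (by linarith) le_rfl
    rw [add_sub_cancel_left] at h
    have h' := mul_le_mul_of_nonneg_left h hqR.le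
    rw [← abs_of_pos hqR, ← abs_mul, abs_of_pos hqR] at h'
    rwa [mul_sub, ← mul_assoc, ← mul_assoc, mul_one_div_cancel hqR.ne', one_mul, one_mul] at h'
  calc |(∑ i ∈ Finset.range q, g (x + i * α)) - q * ∫ t in (0 : ℝ)..1, g t|
      = |∑ i ∈ Finset.range q, (g (x + i * α) - A (x + i * (p / q)))| := by
        rw [Finset.sum_sub_distrib, hAper.sum_range_add_mul_div hq hpq, hAsum]
    _ ≤ ∑ i ∈ Finset.range q, D (x + i * (p / q)) :=
        (Finset.abs_sum_le_sum_abs _ _).trans (Finset.sum_le_sum hpt)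
    _ = 2 * c := by rw [hDper.sum_range_add_mul_div hq hpq, hDsum]

/-- An irrational number has Dirichlet approximations with arbitrarily large denominators. -/
lemma Irrational.exists_rat_lt_den_abs_sub_lt {α : ℝ} (hα : Irrational α) (N : ℕ) :
    ∃ r : ℚ, N < r.den ∧ |α - r| < 1 / (r.den : ℝ) ^ 2 := by
  by_contra! hcon
  refine Real.infinite_rat_abs_sub_lt_one_div_den_sq_of_irrational hα ?_
  obtain ⟨K, hK⟩ := exists_nat_ge ((|α| + 1) * N)
  refine ((((Set.finite_Icc (-(K : ℤ)) K).prod (Set.finite_Icc 0 N)).image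
    fun z : ℤ × ℕ => (z.1 : ℚ) / z.2)).subset fun r hr => ?_
  have hr' : |α - r| < 1 / (r.den : ℝ) ^ 2 := hr
  have hden : r.den ≤ N := not_lt.1 fun h => (hcon r h).not_gt hr'
  have hd1 : (1 : ℝ) ≤ r.den := by exact_mod_cast r.pos
  have hle1 : 1 / (r.den : ℝ) ^ 2 ≤ 1 := by
    rw [div_le_one (by positivity)]
    exact one_le_pow₀ hd1
  have hrabs : |(r : ℝ)| ≤ |α| + 1 := by
    have h := abs_sub_abs_le_abs_sub (r : ℝ) α
    rw [abs_sub_comm] at h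
    linarith
  have hnum : |(r.num : ℝ)| ≤ K := by
    have : (r.num : ℝ) = r * r.den := by exact_mod_cast (Rat.mul_den_eq_num r).symm
    rw [this, abs_mul, Nat.abs_cast]
    refine le_trans ?_ hK
    gcongr
  have hnum' : |r.num| ≤ (K : ℤ) := by exact_mod_cast hnum
  exact ⟨(r.num, r.den), ⟨abs_le.1 hnum', Nat.zero_le _, hden⟩, r.num_div_den⟩

/-- Splitting a Birkhoff sum into blocks of length `q`. -/
lemma abs_birkhoff_sub_le_of_block_le {g : ℝ → ℝ} {α I B c : ℝ} {q : ℕ}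
    (hB : ∀ x, |(∑ i ∈ Finset.range q, g (x + i * α)) - q * I| ≤ B)
    (hc : ∀ x, |g x - I| ≤ c) (r k : ℕ) (x : ℝ) :
    |(∑ i ∈ Finset.range (q * k + r), g (x + i * α)) - (q * k + r : ℕ) * I| ≤ k * B + r * c := by
  induction k generalizing x with
  | zero =>
    have : (∑ i ∈ Finset.range r, g (x + i * α)) - r * I =
        ∑ i ∈ Finset.range r, (g (x + i * α) - I) := by
      simp [Finset.sum_sub_distrib]
    simp only [mul_zero, zero_add, this, Nat.cast_zero, zero_mul]
    refine (Finset.abs_sum_le_sum_abs _ _).trans ?_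
    simpa using Finset.sum_le_sum (s := Finset.range r) fun i _ => hc (x + i * α)
  | succ k ih =>
    have h1 := hB x
    have h2 := ih (x + q * α)
    have hsum : ∑ i ∈ Finset.range (q * (k + 1) + r), g (x + i * α) =
        (∑ i ∈ Finset.range q, g (x + i * α)) +
          ∑ i ∈ Finset.range (q * k + r), g (x + q * α + i * α) := by
      rw [show q * (k + 1) + r = q + (q * k + r) by ring, Finset.sum_range_add]
      congr 1
      refine Finset.sum_congr rfl fun i _ => ?_
      push_cast
      congr 1
      ring
    rw [hsum]
    push_cast at h2 ⊢
    rw [abs_le] at h1 h2 ⊢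
    constructor <;> linarith [h1.1, h1.2, h2.1, h2.2]

/-- uniform ergodic theorem for BV functions, Lemma 5.3:
for irrational `α` and a `1`-periodic function `g` of bounded variation,
`sup_x |S_M(g)(x) − M ∫_𝕋 g| = o(M)` as `M → ∞`; stated in `ε`-form. -/
theorem stmt14 (α : ℝ) (hα : Irrational α) (g : ℝ → ℝ)
    (hper : Function.Periodic g 1)
    (hBV : eVariationOn g (Set.Icc 0 1) ≠ ⊤) :
    ∀ ε : ℝ, 0 < ε → ∃ M₀ : ℕ, ∀ M : ℕ, M₀ ≤ M → ∀ x : ℝ,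
      |(∑ i ∈ Finset.range M, g (x + i * α)) - (M : ℝ) * ∫ t in (0 : ℝ)..1, g t| ≤ ε * M := by
  intro ε hε
  obtain ⟨W, c, hWc, hW⟩ := exists_quasiperiodic_control hper hBV
  have hc : ∀ x, |g x - ∫ t in (0 : ℝ)..1, g t| ≤ c := fun x => by
    have h := abs_mul_sub_integral_le_of_control hW (a := x) (b := x + 1) (a' := x) (b' := x + 1)
      (t := x) ⟨le_rfl, by linarith⟩ le_rfl (by linarith) le_rfl
    have hend := hper.intervalIntegral_add_eq x 0
    rw [zero_add] at hend
    rw [hend] at h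
    simpa [hWc] using h
  have hc0 : 0 ≤ c := (abs_nonneg _).trans (hc 0)
  obtain ⟨N, hN⟩ := exists_nat_ge (4 * c / ε)
  obtain ⟨r, hrN, hr⟩ := hα.exists_rat_lt_den_abs_sub_lt N
  set q := r.den
  have hq : 0 < q := r.pos
  have hqR : (0 : ℝ) < q := by exact_mod_cast hq
  have hcop : IsCoprime r.num q := Int.isCoprime_iff_nat_coprime.2 (by simpa using r.reduced)
  have hr' : |α - r.num / q| ≤ 1 / (q : ℝ) ^ 2 := by
    rw [show ((r.num : ℝ) / q) = r by exact_mod_cast r.num_div_den]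
    exact hr.le
  have hblock := abs_birkhoff_sub_integral_le hper hWc hW hq hcop hr'
  have hqc : 4 * c ≤ ε * q := by
    have : 4 * c / ε ≤ q := hN.trans (by exact_mod_cast hrN.le)
    rwa [div_le_iff₀ hε, mul_comm _ ε] at this
  obtain ⟨M₀, hM₀⟩ := exists_nat_ge (2 * (q * c) / ε)
  refine ⟨M₀, fun M hM x => ?_⟩
  have h := abs_birkhoff_sub_le_of_block_le hblock hc (M % q) (M / q) x
  rw [Nat.div_add_mod] at h
  refine h.trans ?_
  have hM' : 2 * (q * c) ≤ ε * M := by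
    have : 2 * (q * c) / ε ≤ M := hM₀.trans (by exact_mod_cast hM)
    rwa [div_le_iff₀ hε, mul_comm _ ε] at this
  have hmod : ((M % q : ℕ) : ℝ) * c ≤ q * c := by
    gcongr
    exact (Nat.mod_lt M hq).le
  have hdiv : ((M / q : ℕ) : ℝ) * q ≤ M := by exact_mod_cast Nat.div_mul_le_self M q
  have h1 := mul_le_mul_of_nonneg_left hqc (Nat.cast_nonneg (α := ℝ) (M / q))
  have h2 := mul_le_mul_of_nonneg_left hdiv hε.le
  linarith
end

section
/- Let X be a compact metric space, T : X → X a homeomorphism, and μ a T-invariant Borel probability measure such that Birkhoff averages of continuous functions converge uniformly to the mean: for every continuous g : X → ℝ, (1/N)∑_{n=0}^{N−1} g(Tⁿx) → ∫_X g dμ uniformly in x ∈ X as N → ∞. Then for every continuous g : X → ℝ with ∫_X g dμ = 0 and every ε > 0 there exists a continuous h : X → ℝ such that sup_{x∈X} |g(x) − (h(x) − h(Tx))| < ε; that is, continuous coboundaries h − h∘T are dense in the uniform topology among mean-zero continuous functions. -/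
open MeasureTheory

/-- A function differs from its Birkhoff average by the coboundary of the average of its
Birkhoff sums. -/
theorem sub_coboundary_eq_birkhoffAverage {X : Type*} (f : X → X) (g : X → ℝ) {N : ℕ}
    (hN : N ≠ 0) (x : X) :
    g x - ((N : ℝ)⁻¹ * ∑ k ∈ Finset.range N, birkhoffSum f g k x -
      (N : ℝ)⁻¹ * ∑ k ∈ Finset.range N, birkhoffSum f g k (f x)) =
      (N : ℝ)⁻¹ * ∑ n ∈ Finset.range N, g (f^[n] x) := by
  have hN' : (N : ℝ) ≠ 0 := Nat.cast_ne_zero.mpr hN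
  have key : ∑ k ∈ Finset.range N, birkhoffSum f g k x -
      ∑ k ∈ Finset.range N, birkhoffSum f g k (f x) =
      N * g x - ∑ n ∈ Finset.range N, g (f^[n] x) := by
    rw [← Finset.sum_sub_distrib, Finset.sum_congr rfl fun k _ => show _ = g x - g (f^[k] x) by
      linarith [birkhoffSum_apply_sub_birkhoffSum f g k x]]
    simp
  rw [← mul_sub, key]
  field_simp
  ring

/-- for a homeomorphism `T` of a compact metric space `X` preserving a Borel
probability measure `μ`, if Birkhoff averages of continuous functions converge uniformly to
the mean, then continuous coboundaries `h − h ∘ T` are uniformly dense among mean-zero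
continuous functions. -/
theorem stmt19 {X : Type*} [MetricSpace X] [CompactSpace X]
    [MeasurableSpace X] [BorelSpace X]
    (T : X ≃ₜ X) (μ : Measure X) [IsProbabilityMeasure μ]
    (hinv : MeasurePreserving (⇑T) μ μ)
    (huniq : ∀ g : X → ℝ, Continuous g →
      TendstoUniformly
        (fun N : ℕ => fun x : X => (N : ℝ)⁻¹ * ∑ n ∈ Finset.range N, g ((⇑T)^[n] x))
        (fun _ => ∫ x, g x ∂μ) Filter.atTop) :
    ∀ g : X → ℝ, Continuous g → (∫ x, g x ∂μ) = 0 →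
      ∀ ε : ℝ, 0 < ε → ∃ h : X → ℝ, Continuous h ∧
        ∀ x : X, |g x - (h x - h (T x))| < ε := by
  intro g hg hg0 ε hε
  obtain ⟨N, hN, hN0⟩ := ((Metric.tendstoUniformly_iff.mp (huniq g hg) ε hε).and
    (Filter.eventually_ne_atTop 0)).exists
  refine ⟨fun x => (N : ℝ)⁻¹ * ∑ k ∈ Finset.range N, birkhoffSum T g k x, ?_, fun x => ?_⟩
  · exact continuous_const.mul <| continuous_finsetSum _ fun k _ =>
      continuous_finsetSum _ fun n _ => hg.comp (T.continuous.iterate n)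
  · rw [sub_coboundary_eq_birkhoffAverage T g hN0]
    simpa [hg0, Real.dist_eq, abs_sub_comm] using hN x
end
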